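/- Optimality example. Define u : ℝ² → ℝ by u(x,y) = Im((x+iy)^{1/2}), using the principal branch of the complex square root. Then: (i) u is harmonic on the upper half-plane H = {(x,y) ∈ ℝ² : y > 0}; (ii) u extends continuously to closure(H) with u(x,0) = 0 for all x > 0; (iii) the normal derivative vanishes on the other part of the boundary: ∂u/∂y(x,0) = 0 for all x < 0; and (iv) the gradient satisfies |∇u(x,y)| = (1/2)(x²+y²)^{-1/4} on H, so ∇u ∈ L^p(B₁ ∩ H) for every p < 4 but ∇u ∉ L⁴(B₁ ∩ H), where B₁ is the unit disk. In particular, the gradient of a solution to the mixed Dirichlet–conormal problem for the Laplace equation with flat boundary and flat separation need not lie in L⁴, showing the range p ∈ (4/3, 4) is optimal when m = 0. -/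

import Mathlib

open Set MeasureTheory

noncomputable section

namespace SqrtExample

/-- u(x,y) = Im((x+iy)^{1/2}), with the principal branch of the complex square root. -/
def u (X : ℝ × ℝ) : ℝ := (((X.1 : ℂ) + (X.2 : ℂ) * Complex.I) ^ ((1 : ℂ) / 2)).im

/-- The upper half-plane H = {(x,y) : y > 0}. -/
def H : Set (ℝ × ℝ) := {X : ℝ × ℝ | 0 < X.2}

/-- The open unit disk B₁ ⊂ ℝ². -/
def disk : Set (ℝ × ℝ) := {X : ℝ × ℝ | X.1 ^ 2 + X.2 ^ 2 < 1}

/-- The squared length of the gradient of u. -/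
def gradSq (X : ℝ × ℝ) : ℝ :=
  (fderiv ℝ u X (1, 0)) ^ 2 + (fderiv ℝ u X (0, 1)) ^ 2

/-- The identification of the plane with `ℂ`, `(x, y) ↦ x + iy`. -/
def toComplex : ℝ × ℝ →L[ℝ] ℂ := Complex.equivRealProdCLM.symm

theorem toComplex_apply (X : ℝ × ℝ) : toComplex X = (X.1 : ℂ) + (X.2 : ℂ) * Complex.I := by
  exact Complex.equivRealProd_symm_apply X

theorem u_eq_im_cpow (X : ℝ × ℝ) : u X = (toComplex X ^ ((1 : ℂ) / 2)).im := by
  rw [toComplex_apply, u]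

theorem toComplex_re (X : ℝ × ℝ) : (toComplex X).re = X.1 := by simp [toComplex_apply]

theorem toComplex_im (X : ℝ × ℝ) : (toComplex X).im = X.2 := by simp [toComplex_apply]

theorem norm_toComplex (X : ℝ × ℝ) : ‖toComplex X‖ = √(X.1 ^ 2 + X.2 ^ 2) := by
  rw [toComplex_apply, Complex.norm_add_mul_I]

theorem toComplex_mem_slitPlane {X : ℝ × ℝ} (hX : X ∈ H) : toComplex X ∈ Complex.slitPlane :=
  Or.inr (by rw [toComplex_im]; exact ne_of_gt hX)

theorem isOpen_H : IsOpen H := isOpen_lt continuous_const continuous_snd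

theorem fderiv_im_comp_toComplex {g : ℂ → ℂ} {g' : ℂ} {X : ℝ × ℝ}
    (hg : HasDerivAt g g' (toComplex X)) (v : ℝ × ℝ) :
    fderiv ℝ (fun Y => (g (toComplex Y)).im) X v = (g' * toComplex v).im := by
  have h := Complex.imCLM.hasFDerivAt.comp X
    ((hg.hasFDerivAt.restrictScalars ℝ).comp X toComplex.hasFDerivAt)
  have h' := congrArg (fun L => L v) h.fderiv
  simpa [Function.comp_def, mul_comm] using h'

theorem fderiv_re_comp_toComplex {g : ℂ → ℂ} {g' : ℂ} {X : ℝ × ℝ}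
    (hg : HasDerivAt g g' (toComplex X)) (v : ℝ × ℝ) :
    fderiv ℝ (fun Y => (g (toComplex Y)).re) X v = (g' * toComplex v).re := by
  have h := Complex.reCLM.hasFDerivAt.comp X
    ((hg.hasFDerivAt.restrictScalars ℝ).comp X toComplex.hasFDerivAt)
  have h' := congrArg (fun L => L v) h.fderiv
  simpa [Function.comp_def, mul_comm] using h'

theorem hasDerivAt_cpow_const {z : ℂ} (hz : z ∈ Complex.slitPlane) (c : ℂ) :
    HasDerivAt (fun w => w ^ c) (c * z ^ (c - 1)) z := by
  simpa using (hasDerivAt_id z).cpow_const (c := c) hz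

/-- The complex derivative of the principal square root. -/
def sqrtDeriv (z : ℂ) : ℂ := 1 / 2 * z ^ ((1 : ℂ) / 2 - 1)

theorem fderiv_u_fst {X : ℝ × ℝ} (hX : X ∈ H) :
    fderiv ℝ u X (1, 0) = (sqrtDeriv (toComplex X)).im := by
  have h := fderiv_im_comp_toComplex
    (hasDerivAt_cpow_const (toComplex_mem_slitPlane hX) (1 / 2)) (1, 0)
  simp only [← u_eq_im_cpow] at h
  rw [h, toComplex_apply (1, 0)]
  simp [sqrtDeriv]

theorem fderiv_u_snd {X : ℝ × ℝ} (hX : X ∈ H) :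
    fderiv ℝ u X (0, 1) = (sqrtDeriv (toComplex X)).re := by
  have h := fderiv_im_comp_toComplex
    (hasDerivAt_cpow_const (toComplex_mem_slitPlane hX) (1 / 2)) (0, 1)
  simp only [← u_eq_im_cpow] at h
  rw [h, toComplex_apply (0, 1), sqrtDeriv]
  simp only [Complex.ofReal_zero, Complex.ofReal_one, zero_add, one_mul, Complex.mul_I_im]

theorem contDiffOn_u : ContDiffOn ℝ 2 u H := by
  intro X hX
  have h : AnalyticAt ℂ (fun z : ℂ => z ^ ((1 : ℂ) / 2)) (toComplex X) :=
    analyticAt_id.cpow analyticAt_const (toComplex_mem_slitPlane hX)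
  have h' := Complex.imCLM.contDiff.contDiffAt.comp X
    ((h.contDiffAt (n := 2).restrict_scalars ℝ).comp X toComplex.contDiff.contDiffAt)
  exact (h'.congr_of_eventuallyEq
    (Filter.Eventually.of_forall u_eq_im_cpow)).contDiffWithinAt

theorem laplacian_u {X : ℝ × ℝ} (hX : X ∈ H) :
    fderiv ℝ (fun Y => fderiv ℝ u Y (1, 0)) X (1, 0) +
      fderiv ℝ (fun Y => fderiv ℝ u Y (0, 1)) X (0, 1) = 0 := by
  have hH := isOpen_H.mem_nhds hX
  have h1 : (fun Y => fderiv ℝ u Y (1, 0)) =ᶠ[nhds X] fun Y => (sqrtDeriv (toComplex Y)).im := by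
    filter_upwards [hH] with Y hY using fderiv_u_fst hY
  have h2 : (fun Y => fderiv ℝ u Y (0, 1)) =ᶠ[nhds X] fun Y => (sqrtDeriv (toComplex Y)).re := by
    filter_upwards [hH] with Y hY using fderiv_u_snd hY
  have hd := (hasDerivAt_cpow_const (toComplex_mem_slitPlane hX) ((1 : ℂ) / 2 - 1)).const_mul
    ((1 : ℂ) / 2)
  rw [h1.fderiv_eq, h2.fderiv_eq, fderiv_im_comp_toComplex (g := sqrtDeriv) hd,
    fderiv_re_comp_toComplex (g := sqrtDeriv) hd, toComplex_apply (1, 0), toComplex_apply (0, 1)]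
  simp only [Complex.ofReal_zero, Complex.ofReal_one, zero_add, one_mul, zero_mul, add_zero,
    mul_one, Complex.mul_I_re]
  ring

theorem u_eq_sqrt {X : ℝ × ℝ} (hX : 0 ≤ X.2) :
    u X = √((√(X.1 ^ 2 + X.2 ^ 2) - X.1) / 2) := by
  rw [u_eq_im_cpow, one_div, Complex.cpow_inv_two_im_eq_sqrt (by rwa [toComplex_im]),
    norm_toComplex, toComplex_re]

theorem continuousOn_u : ContinuousOn u (closure H) := by
  have hsub : closure H ⊆ {X : ℝ × ℝ | 0 ≤ X.2} :=
    closure_minimal (fun X (hX : 0 < X.2) => hX.le) (isClosed_le continuous_const continuous_snd)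
  have hc : Continuous fun X : ℝ × ℝ => √((√(X.1 ^ 2 + X.2 ^ 2) - X.1) / 2) := by fun_prop
  exact hc.continuousOn.congr fun X hX => u_eq_sqrt (hsub hX)

theorem hasDerivWithinAt_u_snd {x : ℝ} (hx : x < 0) :
    HasDerivWithinAt (fun y : ℝ => u (x, y)) 0 (Ici 0) 0 := by
  have hx2 : x ^ 2 + (0 : ℝ) ^ 2 ≠ 0 := by simp [hx.ne]
  have h1 : HasDerivAt (fun y : ℝ => x ^ 2 + y ^ 2) 0 0 := by
    simpa using ((hasDerivAt_id (0 : ℝ)).pow 2).const_add (x ^ 2)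
  have h2 := ((h1.sqrt hx2).sub_const x).div_const 2
  have hne : (√(x ^ 2 + (0 : ℝ) ^ 2) - x) / 2 ≠ 0 := by
    have := Real.sqrt_nonneg (x ^ 2 + (0 : ℝ) ^ 2)
    exact (half_pos (sub_pos.2 (hx.trans_le this))).ne'
  have h3 := h2.sqrt hne
  simp only [zero_div] at h3
  exact h3.hasDerivWithinAt.congr (fun y hy => u_eq_sqrt hy) (u_eq_sqrt le_rfl)

theorem sqrt_gradSq {X : ℝ × ℝ} (hX : X ∈ H) :
    √(gradSq X) = 1 / 2 * (X.1 ^ 2 + X.2 ^ 2) ^ (-(1 / 4) : ℝ) := by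
  have hpos : 0 < X.1 ^ 2 + X.2 ^ 2 := by
    have : 0 < X.2 := hX
    positivity
  have hnorm : √(gradSq X) = ‖sqrtDeriv (toComplex X)‖ := by
    rw [gradSq, fderiv_u_fst hX, fderiv_u_snd hX, Complex.norm_eq_sqrt_sq_add_sq, add_comm]
  have hexp : (1 : ℂ) / 2 - 1 = ((-(1 / 2) : ℝ) : ℂ) := by push_cast; norm_num
  rw [hnorm, sqrtDeriv, norm_mul, hexp, Complex.norm_cpow_real, norm_toComplex, Real.sqrt_eq_rpow,
    ← Real.rpow_mul hpos.le]
  norm_num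

/-- Polar coordinates turn the integral of `|∇u| ^ p` over the half disk into a radial integral. -/
theorem lintegral_gradSq_rpow (p : ℝ) :
    (∫⁻ X in disk ∩ H, ENNReal.ofReal (√(gradSq X) ^ p)) =
      ENNReal.ofReal ((1 / 2) ^ p) * (∫⁻ r in Ioo (0 : ℝ) 1, ENNReal.ofReal (r ^ (1 - p / 2))) *
        ENNReal.ofReal Real.pi := by
  have hdisk : MeasurableSet disk :=
    (isOpen_lt (by fun_prop) continuous_const : IsOpen disk).measurableSet
  have hpi := Real.pi_pos
  have hsub : Ioo (0 : ℝ) 1 ×ˢ Ioo 0 Real.pi ⊆ polarCoord.target :=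
    prod_mono (fun r hr => hr.1) (Ioo_subset_Ioo_left (by linarith))
  have hpolar : EqOn
      (fun q : ℝ × ℝ => ENNReal.ofReal q.1 • (disk ∩ H).indicator
        (fun X => ENNReal.ofReal (√(gradSq X) ^ p)) (polarCoord.symm q))
      ((Ioo (0 : ℝ) 1 ×ˢ Ioo 0 Real.pi).indicator
        fun q => ENNReal.ofReal ((1 / 2) ^ p) * ENNReal.ofReal (q.1 ^ (1 - p / 2)) * 1)
      polarCoord.target := by
    rintro ⟨r, θ⟩ ⟨hr, hθ⟩
    simp only [mem_Ioi] at hr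
    have hsq : (r * Real.cos θ) ^ 2 + (r * Real.sin θ) ^ 2 = r ^ 2 := by
      linear_combination r ^ 2 * Real.cos_sq_add_sin_sq θ
    have hmem : polarCoord.symm (r, θ) ∈ disk ∩ H ↔ (r, θ) ∈ Ioo (0 : ℝ) 1 ×ˢ Ioo 0 Real.pi := by
      have hr1 : r ^ 2 < 1 ↔ r < 1 := by
        rw [sq_lt_one_iff₀ hr.le]
      have hsin : 0 < r * Real.sin θ ↔ 0 < θ := by
        rw [mul_pos_iff_of_pos_left hr]
        refine ⟨fun h => ?_, fun h => Real.sin_pos_of_pos_of_lt_pi h hθ.2⟩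
        by_contra hneg
        exact absurd (Real.sin_nonpos_of_nonpos_of_neg_pi_le (not_lt.1 hneg) hθ.1.le) (not_le.2 h)
      simp only [polarCoord_symm_apply, disk, H, mem_inter_iff, mem_ofPred_eq, hsq, hr1, hsin,
        mem_prod, mem_Ioo, hr, true_and, hθ.2, and_true]
    by_cases hq : (r, θ) ∈ Ioo (0 : ℝ) 1 ×ˢ Ioo 0 Real.pi
    · have hX := hmem.2 hq
      have hval : r * (√(gradSq (polarCoord.symm (r, θ))) ^ p) =
          (1 / 2) ^ p * r ^ (1 - p / 2) := by
        rw [sqrt_gradSq hX.2, polarCoord_symm_apply, hsq, ← Real.rpow_natCast,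
          ← Real.rpow_mul hr.le, Real.mul_rpow (by norm_num) (by positivity),
          ← Real.rpow_mul hr.le, mul_left_comm]
        congr 1
        nth_rewrite 1 [← Real.rpow_one r]
        rw [← Real.rpow_add hr]
        congr 1
        push_cast
        ring
      simp only [indicator_of_mem hX, indicator_of_mem hq, smul_eq_mul, mul_one]
      rw [← ENNReal.ofReal_mul hr.le, hval, ENNReal.ofReal_mul (by positivity)]
    · simp only [indicator_of_notMem hq, indicator_of_notMem (mt hmem.1 hq), smul_zero]
  rw [← lintegral_indicator (hdisk.inter isOpen_H.measurableSet),
    ← lintegral_comp_polarCoord_symm,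
    setLIntegral_congr_fun polarCoord.open_target.measurableSet hpolar,
    setLIntegral_indicator (measurableSet_Ioo.prod measurableSet_Ioo),
    inter_eq_self_of_subset_left hsub, Measure.volume_eq_prod, ← Measure.prod_restrict,
    lintegral_prod_mul (f := fun r : ℝ => ENNReal.ofReal ((1 / 2) ^ p) *
      ENNReal.ofReal (r ^ (1 - p / 2))) (g := fun _ => 1) (by fun_prop) (by fun_prop),
    lintegral_const_mul _ (by fun_prop)]
  simp

theorem lintegral_rpow_lt_top_iff (s : ℝ) :
    (∫⁻ r in Ioo (0 : ℝ) 1, ENNReal.ofReal (r ^ s)) < ⊤ ↔ -1 < s := by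
  rw [← intervalIntegral.integrableOn_Ioo_rpow_iff (s := s) zero_lt_one, IntegrableOn, Integrable,
    hasFiniteIntegral_iff_ofReal]
  · exact (and_iff_right (by fun_prop)).symm
  · exact ae_restrict_of_forall_mem measurableSet_Ioo fun r hr => Real.rpow_nonneg hr.1.le s

/-- The optimality example: u = Im((x+iy)^{1/2}) is harmonic on the upper half-plane,
vanishes on {x > 0, y = 0}, has vanishing (one-sided) normal derivative on {x < 0, y = 0},
and |∇u| = (1/2)(x²+y²)^{-1/4}, so ∇u ∈ L^p(B₁ ∩ H) for all p < 4 but ∇u ∉ L⁴(B₁ ∩ H).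
This shows the range p ∈ (4/3, 4) for the mixed Dirichlet-conormal problem is optimal
when m = 0. -/
theorem optimality_example :
    -- (i) u is harmonic (C² with vanishing Laplacian) on H
    (ContDiffOn ℝ 2 u H ∧
      ∀ X ∈ H,
        fderiv ℝ (fun Y => fderiv ℝ u Y (1, 0)) X (1, 0) +
          fderiv ℝ (fun Y => fderiv ℝ u Y (0, 1)) X (0, 1) = 0) ∧
    -- (ii) u is continuous up to the boundary and vanishes on {x > 0, y = 0}
    (ContinuousOn u (closure H) ∧ ∀ x : ℝ, 0 < x → u (x, 0) = 0) ∧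
    -- (iii) the (one-sided) normal derivative vanishes on {x < 0, y = 0}
    (∀ x : ℝ, x < 0 → HasDerivWithinAt (fun y : ℝ => u (x, y)) 0 (Ici 0) 0) ∧
    -- (iv) |∇u| = (1/2)(x²+y²)^{-1/4} on H ...
    (∀ X ∈ H, Real.sqrt (gradSq X) = 1 / 2 * (X.1 ^ 2 + X.2 ^ 2) ^ (-(1 / 4) : ℝ)) ∧
    -- ... hence ∇u ∈ L^p(B₁ ∩ H) for every p < 4 ...
    (∀ p : ℝ, 0 < p → p < 4 →
      (∫⁻ X in disk ∩ H, ENNReal.ofReal (Real.sqrt (gradSq X) ^ p)) < ⊤) ∧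
    -- ... but ∇u ∉ L⁴(B₁ ∩ H)
    (∫⁻ X in disk ∩ H, ENNReal.ofReal (Real.sqrt (gradSq X) ^ (4 : ℝ))) = ⊤ := by
  refine ⟨⟨contDiffOn_u, fun X hX => laplacian_u hX⟩, ⟨continuousOn_u, fun x hx => ?_⟩,
    fun x hx => hasDerivWithinAt_u_snd hx, fun X hX => sqrt_gradSq hX, fun p _ hp => ?_, ?_⟩
  · simp [u_eq_sqrt (X := (x, 0)) le_rfl, Real.sqrt_sq hx.le]
  · rw [lintegral_gradSq_rpow]
    have h := (lintegral_rpow_lt_top_iff (1 - p / 2)).2 (by linarith)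
    exact ENNReal.mul_lt_top (ENNReal.mul_lt_top ENNReal.ofReal_lt_top h) ENNReal.ofReal_lt_top
  · have h := (lintegral_rpow_lt_top_iff (1 - 4 / 2)).not.2 (by norm_num)
    rw [lintegral_gradSq_rpow, not_lt_top_iff.1 h, ENNReal.mul_top, ENNReal.top_mul]
    · simp [Real.pi_pos]
    · exact (ENNReal.ofReal_pos.2 (by positivity)).ne'

end SqrtExample
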